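/- arXiv:math/0105067 — 6 statements merged into one kernel-verified Lean document; each statement's English description precedes it below -/
import Mathlib

section
/- Let ω = (ω₁, ω₂) with ω₁, ω₂ > 0 and slope α = ω₂/ω₁ > 1, let a = ⌊α⌋, let 0 < σ < min(ω₁, ω₂), and let 1/2 < κ < 1. If κ ≥ 1 - ‖ω‖^{-1} · min{ a(ω₁ - σ), 2(ω₂ - σ) - a(ω₁ + σ) }, then I⁺_σ(ω) ⊆ I^κ_a, i.e. every k ∈ ℤ² with |ω·k| ≤ σ‖k‖ satisfies ‖T_a k‖ ≤ κ‖k‖. -/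
/-- The estimate for a real vector `(-u, v)` with `u, v ≥ 0`. -/
theorem add_abs_le_of_resonant {ω₁ ω₂ σ κ a u v : ℝ} (hω : 0 < ω₁ + ω₂) (ha : 0 ≤ a)
    (h₁ : (1 - κ) * (ω₁ + ω₂) ≤ a * (ω₁ - σ))
    (h₂ : (1 - κ) * (ω₁ + ω₂) ≤ 2 * (ω₂ - σ) - a * (ω₁ + σ))
    (hu : 0 ≤ u) (hv : 0 ≤ v) (h : |ω₂ * v - ω₁ * u| ≤ σ * (u + v)) :
    v + |a * v - u| ≤ κ * (u + v) := by
  obtain ⟨hl, hr⟩ := abs_le.mp h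
  have huv : 0 ≤ u + v := add_nonneg hu hv
  have hav : (1 - κ) * (u + v) ≤ a * v := by
    refine le_of_mul_le_mul_right ?_ hω
    linarith [mul_le_mul_of_nonneg_right h₁ huv,
      mul_le_mul_of_nonneg_left (show (ω₁ - σ) * (u + v) ≤ v * (ω₁ + ω₂) by linarith) ha]
  have huav : (1 - κ) * (u + v) ≤ 2 * u - a * v := by
    refine le_of_mul_le_mul_right ?_ hω
    linarith [mul_le_mul_of_nonneg_right h₂ huv,
      mul_le_mul_of_nonneg_left (show v * (ω₁ + ω₂) ≤ (ω₁ + σ) * (u + v) by linarith) ha]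
  rcases abs_cases (a * v - u) with ⟨h, _⟩ | ⟨h, _⟩ <;> rw [h] <;> linarith

/-- A nonzero vector whose entries have the same sign is not resonant. -/
theorem eq_zero_of_resonant_of_nonneg {ω₁ ω₂ σ x y : ℝ} (h₁ : σ < ω₁) (h₂ : σ < ω₂)
    (hx : 0 ≤ x) (hy : 0 ≤ y) (h : ω₁ * x + ω₂ * y ≤ σ * (x + y)) : x = 0 ∧ y = 0 := by
  constructor <;> nlinarith [mul_nonneg (sub_pos.mpr h₁).le hx, mul_nonneg (sub_pos.mpr h₂).le hy]

/-- Lemma: if `κ ≥ 1 - ‖ω‖⁻¹ min{a(ω₁-σ), 2(ω₂-σ) - a(ω₁+σ)}`, then every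
resonant mode `k ∈ I⁺_σ(ω)` (i.e. `|ω·k| ≤ σ‖k‖`) lies in `I^κ_a`
(i.e. `‖T_a k‖ ≤ κ‖k‖`), where `T_a` has rows `(0,1)` and `(1,a)` and
norms are `ℓ¹`. -/
theorem stmt_9 (ω₁ ω₂ : ℝ) (hω₁ : 0 < ω₁) (hω₂ : 0 < ω₂)
    (α : ℝ) (hα : α = ω₂ / ω₁) (hα1 : 1 < α)
    (a : ℤ) (ha : a = ⌊α⌋)
    (σ : ℝ) (hσ0 : 0 < σ) (hσ : σ < min ω₁ ω₂)
    (κ : ℝ) (hκ1 : 1 / 2 < κ) (hκ2 : κ < 1)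
    (hκ : κ ≥ 1 - (ω₁ + ω₂)⁻¹ *
        min ((a : ℝ) * (ω₁ - σ)) (2 * (ω₂ - σ) - (a : ℝ) * (ω₁ + σ))) :
    ∀ k : ℤ × ℤ,
      |ω₁ * (k.1 : ℝ) + ω₂ * (k.2 : ℝ)| ≤ σ * (|(k.1 : ℝ)| + |(k.2 : ℝ)|) →
      |(k.2 : ℝ)| + |(k.1 : ℝ) + (a : ℝ) * (k.2 : ℝ)| ≤
        κ * (|(k.1 : ℝ)| + |(k.2 : ℝ)|) := by
  rintro ⟨x, y⟩ h
  dsimp only at h ⊢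
  generalize (x : ℝ) = x at h ⊢
  generalize (y : ℝ) = y at h ⊢
  obtain ⟨hσ₁, hσ₂⟩ := lt_min_iff.mp hσ
  have hω : 0 < ω₁ + ω₂ := add_pos hω₁ hω₂
  have ha0 : (0 : ℝ) ≤ a := by
    rw [ha]
    exact_mod_cast Int.floor_nonneg.mpr (zero_le_one.trans hα1.le)
  have hmin : (1 - κ) * (ω₁ + ω₂) ≤
      min ((a : ℝ) * (ω₁ - σ)) (2 * (ω₂ - σ) - (a : ℝ) * (ω₁ + σ)) := by
    rw [← le_inv_mul_iff₀' hω]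
    linarith
  obtain ⟨h₁, h₂⟩ := le_min_iff.mp hmin
  rcases le_total 0 x with hx | hx <;> rcases le_total 0 y with hy | hy
  · rw [abs_of_nonneg hx, abs_of_nonneg hy] at h
    obtain ⟨rfl, rfl⟩ := eq_zero_of_resonant_of_nonneg hσ₁ hσ₂ hx hy ((le_abs_self _).trans h)
    simp
  · rw [abs_of_nonneg hx, abs_of_nonpos hy] at h ⊢
    have key := add_abs_le_of_resonant (v := -y) hω ha0 h₁ h₂ hx (neg_nonneg.mpr hy)
      (by rwa [show ω₂ * -y - ω₁ * x = -(ω₁ * x + ω₂ * y) by ring, abs_neg])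
    rwa [show a * -y - x = -(x + a * y) by ring, abs_neg] at key
  · rw [abs_of_nonpos hx, abs_of_nonneg hy] at h ⊢
    have key := add_abs_le_of_resonant (u := -x) hω ha0 h₁ h₂ (neg_nonneg.mpr hx) hy
      (by rwa [show ω₂ * y - ω₁ * -x = ω₁ * x + ω₂ * y by ring])
    rwa [show a * y - -x = x + a * y by ring] at key
  · rw [abs_of_nonpos hx, abs_of_nonpos hy] at h
    obtain ⟨hx0, hy0⟩ := eq_zero_of_resonant_of_nonneg hσ₁ hσ₂ (neg_nonneg.mpr hx)
      (neg_nonneg.mpr hy) (by linarith [neg_le_abs (ω₁ * x + ω₂ * y)])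
    simp [neg_eq_zero.mp hx0, neg_eq_zero.mp hy0]
end

section
/- Let α > 1, let ω = (1, α), let a = ⌊α⌋, and let 0 < σ < 1/3. If 1/2 < κ < 1 and κ ≥ 1 - (1 - 3σ)/3, then I⁺_σ(ω) ⊆ I^κ_a, i.e. every k ∈ ℤ² with |ω·k| ≤ σ‖k‖ satisfies ‖T_a k‖ ≤ κ‖k‖. -/
/-- The bound on the half-plane `0 ≤ y`, for real vectors `(x, y)`. -/
theorem l1_bound_of_nonneg {α a σ κ x y : ℝ} (ha1 : 1 ≤ a) (haα : a ≤ α) (hαa : α ≤ a + 1)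
    (hσ0 : 0 ≤ σ) (hσ : σ < 1 / 3) (hκ : 2 / 3 + σ ≤ κ) (hy : 0 ≤ y)
    (h : |x + α * y| ≤ σ * (|x| + |y|)) :
    |y| + |x + a * y| ≤ κ * (|x| + |y|) := by
  have hay : a * y ≤ α * y := mul_le_mul_of_nonneg_right haα hy
  have hαy : α * y ≤ (a + 1) * y := mul_le_mul_of_nonneg_right hαa hy
  have hya : y ≤ a * y := le_mul_of_one_le_left hy ha1
  refine le_trans ?_ (mul_le_mul_of_nonneg_right hκ (by positivity))
  rw [abs_of_nonneg hy] at h ⊢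
  obtain ⟨h1, h2⟩ := abs_le.1 h
  rcases le_total 0 x with hx | hx
  · rw [abs_of_nonneg hx] at h2 ⊢
    have hs : σ * (x + y) ≤ 1 / 3 * (x + y) :=
      mul_le_mul_of_nonneg_right hσ.le (by positivity)
    obtain rfl : x = 0 := by linarith
    obtain rfl : y = 0 := by linarith
    simp
  · rw [abs_of_nonpos hx] at h1 h2 ⊢
    have hs0 : 0 ≤ σ * (-x + y) := mul_nonneg hσ0 (by linarith)
    have hs : σ * (-x + y) ≤ 1 / 3 * (-x + y) :=
      mul_le_mul_of_nonneg_right hσ.le (by linarith)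
    rcases abs_cases (x + a * y) with ⟨h, -⟩ | ⟨h, -⟩ <;> rw [h] <;> linarith

/-- Lemma (second part): for `ω = (1, α)` with `α > 1` and `σ < 1/3`, the
choice `κ ≥ 1 - (1 - 3σ)/3` suffices for `I⁺_σ(ω) ⊆ I^κ_a`, where
`a = ⌊α⌋`, `T_a` has rows `(0,1)` and `(1,a)` and norms are `ℓ¹`. -/
theorem stmt_10 (α : ℝ) (hα1 : 1 < α)
    (a : ℤ) (ha : a = ⌊α⌋)
    (σ : ℝ) (hσ0 : 0 < σ) (hσ : σ < 1 / 3)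
    (κ : ℝ) (hκ1 : 1 / 2 < κ) (hκ2 : κ < 1)
    (hκ : κ ≥ 1 - (1 - 3 * σ) / 3) :
    ∀ k : ℤ × ℤ,
      |(k.1 : ℝ) + α * (k.2 : ℝ)| ≤ σ * (|(k.1 : ℝ)| + |(k.2 : ℝ)|) →
      |(k.2 : ℝ)| + |(k.1 : ℝ) + (a : ℝ) * (k.2 : ℝ)| ≤
        κ * (|(k.1 : ℝ)| + |(k.2 : ℝ)|) := by
  rintro ⟨x, y⟩ h
  have ha1 : (1 : ℝ) ≤ a := by
    exact_mod_cast ha ▸ Int.le_floor.2 (by simpa using hα1.le)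
  have haα : (a : ℝ) ≤ α := ha ▸ Int.floor_le α
  have hαa : α ≤ a + 1 := ha ▸ (Int.lt_floor_add_one α).le
  have hκ' : 2 / 3 + σ ≤ κ := by linarith
  rcases le_total (0 : ℝ) y with hy | hy
  · exact l1_bound_of_nonneg ha1 haα hαa hσ0.le hσ hκ' hy h
  · have key := l1_bound_of_nonneg (x := -x) (y := -y) ha1 haα hαa hσ0.le hσ hκ'
      (neg_nonneg.2 hy)
    simp only [mul_neg, ← neg_add, abs_neg] at key
    exact key h
end

section
/- Let a ∈ ℤ, 0 < κ < 1, and 0 < ρ' < ρ with κρ < ρ'. Let c : ℤ² → [0, ∞) be supported on I^κ_a (i.e. c_k = 0 whenever ‖T_a k‖ > κ‖k‖) and suppose ∑_{k∈ℤ²} c_k · e^{ρ'‖k‖} < ∞. Then for every 0 < δ < ρ' - κρ, ∑_{k∈ℤ²} ‖T_a k‖ · c_k · e^{ρ‖T_a k‖} ≤ (κ/δ) · ∑_{k∈ℤ²} c_k · e^{ρ'‖k‖}. -/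
/-- A scalar form of the Cauchy estimate: a loss `δ` in the exponential weight absorbs a linear
factor, at the price of a constant `κ / δ`. -/
theorem mul_exp_le_div_mul_exp {κ ρ ρ' δ s t : ℝ} (hκ : 0 ≤ κ) (hρ : 0 ≤ ρ) (hδ : 0 < δ)
    (hδρ : δ ≤ ρ' - κ * ρ) (ht : 0 ≤ t) (hst : s ≤ κ * t) :
    s * Real.exp (ρ * s) ≤ κ / δ * Real.exp (ρ' * t) := by
  have hlin : δ * t ≤ Real.exp (δ * t) := by linarith [Real.add_one_le_exp (δ * t)]
  calc s * Real.exp (ρ * s) ≤ (κ * t) * Real.exp (ρ * (κ * t)) := by gcongr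
    _ = κ / δ * ((δ * t) * Real.exp (ρ * (κ * t))) := by field_simp
    _ ≤ κ / δ * (Real.exp (δ * t) * Real.exp (ρ * (κ * t))) := by gcongr
    _ = κ / δ * Real.exp (δ * t + ρ * (κ * t)) := by rw [Real.exp_add]
    _ ≤ κ / δ * Real.exp (ρ' * t) := by
      gcongr
      nlinarith [mul_le_mul_of_nonneg_right hδρ ht]

/-- Derivative bound: for nonnegative coefficients `c` supported on
`I^κ_a = {k : ‖T_a k‖ ≤ κ‖k‖}` with `∑ c_k e^{ρ'‖k‖} < ∞`, `κρ < ρ'` and any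
`0 < δ < ρ' - κρ`, one has
`∑ ‖T_a k‖ c_k e^{ρ‖T_a k‖} ≤ (κ/δ) ∑ c_k e^{ρ'‖k‖}`. Here `T_a` has rows
`(0,1)`, `(1,a)` and `‖·‖` is the `ℓ¹` norm on `ℤ²`. -/
theorem stmt_12 (a : ℤ) (κ ρ ρ' : ℝ) (hκ0 : 0 < κ) (hκ1 : κ < 1)
    (hρ'pos : 0 < ρ') (hρ : ρ' < ρ) (hκρ : κ * ρ < ρ')
    (nrm : ℤ × ℤ → ℝ) (hnrm : ∀ k, nrm k = |(k.1 : ℝ)| + |(k.2 : ℝ)|)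
    (T : ℤ × ℤ → ℤ × ℤ) (hT : ∀ k, T k = (k.2, k.1 + a * k.2))
    (c : ℤ × ℤ → ℝ) (hc : ∀ k, 0 ≤ c k)
    (hsupp : ∀ k, κ * nrm k < nrm (T k) → c k = 0)
    (hsum : Summable fun k => c k * Real.exp (ρ' * nrm k)) :
    ∀ δ : ℝ, 0 < δ → δ < ρ' - κ * ρ →
      ∑' k, nrm (T k) * c k * Real.exp (ρ * nrm (T k)) ≤
        (κ / δ) * ∑' k, c k * Real.exp (ρ' * nrm k) := by
  intro δ hδ hδρ
  have hnn : ∀ k, 0 ≤ nrm k := fun k => by rw [hnrm]; positivity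
  have hle : ∀ k, nrm (T k) * c k * Real.exp (ρ * nrm (T k)) ≤
      κ / δ * (c k * Real.exp (ρ' * nrm k)) := by
    intro k
    rcases lt_or_ge (κ * nrm k) (nrm (T k)) with h | h
    · simp [hsupp k h]
    · have := mul_le_mul_of_nonneg_left
        (mul_exp_le_div_mul_exp hκ0.le (hρ'pos.trans hρ).le hδ hδρ.le (hnn k) h) (hc k)
      linarith
  have hmaj := hsum.mul_left (κ / δ)
  rw [← tsum_mul_left]
  refine Summable.tsum_le_tsum hle (Summable.of_nonneg_of_le (fun k => ?_) hle hmaj) hmaj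
  exact mul_nonneg (mul_nonneg (hnn _) (hc k)) (Real.exp_nonneg _)
end

section
/- Let α > 0 be irrational with complete quotients α_n, set Ã_n = ∏_{i=0}^n α_i, and let γ = (1+√5)/2. Then for all 0 ≤ j ≤ n, ∑_{m=j}^{n} Ã_m ≤ γ³ · Ã_n. -/
open Finset in
/-- A positive sequence that is nondecreasing and at least doubles every two steps has
partial sums bounded by four times the last term. -/
lemma sum_range_le_four_mul {T : ℕ → ℝ} (hpos : ∀ n, 0 < T n) (hmono : ∀ n, T n ≤ T (n + 1))
    (hdouble : ∀ n, 2 * T n ≤ T (n + 2)) (n : ℕ) :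
    ∑ m ∈ range (n + 1), T m ≤ 4 * T n := by
  have key : ∀ n, ∑ m ∈ range (n + 2), T m ≤ 2 * (T n + T (n + 1)) := by
    intro n
    induction n with
    | zero =>
      simp only [sum_range_succ, range_zero, sum_empty]
      linarith [hpos 0, hpos 1]
    | succ k ih =>
      rw [sum_range_succ]
      linarith [hdouble k]
  cases n with
  | zero =>
    simp only [sum_range_succ, range_zero, sum_empty]
    linarith [hpos 0]
  | succ k => linarith [key k, hmono k]

/-- The orbit of an irrational number under the Gauss map stays irrational. -/
lemma irrational_gauss_orbit {α : ℝ} (hirr : Irrational α) {x : ℕ → ℝ}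
    (hx0 : x 0 = Int.fract α) (hx : ∀ n, x (n + 1) = Int.fract (1 / x n)) (n : ℕ) :
    Irrational (x n) := by
  induction n with
  | zero => rw [hx0]; exact hirr.sub_intCast _
  | succ k ih => rw [hx, one_div]; exact ih.inv.sub_intCast _

/-- The orbit of an irrational number under the Gauss map stays in the open unit interval. -/
lemma gauss_orbit_mem_Ioo {α : ℝ} (hirr : Irrational α) {x : ℕ → ℝ}
    (hx0 : x 0 = Int.fract α) (hx : ∀ n, x (n + 1) = Int.fract (1 / x n)) (n : ℕ) :
    x n ∈ Set.Ioo (0 : ℝ) 1 := by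
  have hne : x n ≠ 0 := (irrational_gauss_orbit hirr hx0 hx n).ne_zero
  obtain ⟨y, hy⟩ : ∃ y, x n = Int.fract y := by
    cases n with
    | zero => exact ⟨_, hx0⟩
    | succ k => exact ⟨_, hx k⟩
  exact ⟨lt_of_le_of_ne (hy ▸ Int.fract_nonneg y) hne.symm, hy ▸ Int.fract_lt_one y⟩

/-- The product of two consecutive complete quotients of positive index is at least `2`. -/
lemma two_le_one_div_mul_one_div_fract {y : ℝ} (hy : y ∈ Set.Ioo (0 : ℝ) 1)
    (hpos : 0 < Int.fract (1 / y)) : 2 ≤ 1 / y * (1 / Int.fract (1 / y)) := by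
  have hfloor : (1 : ℝ) ≤ ⌊1 / y⌋ := by
    exact_mod_cast Int.le_floor.mpr (by
      rw [Int.cast_one]; exact (one_le_div hy.1).mpr hy.2.le)
  rw [mul_one_div, le_div_iff₀ hpos]
  linarith [Int.floor_add_fract (1 / y), Int.fract_lt_one (1 / y)]

/-- For `α > 0` irrational with complete quotients `A n` and
`Ã_m = ∏_{i=0}^m α_i`, one has `∑_{m=j}^n Ã_m ≤ γ³ Ã_n` for all `0 ≤ j ≤ n`,
where `γ` is the golden ratio. -/
theorem stmt_17 (α : ℝ) (hirr : Irrational α) (hpos : 0 < α)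
    (x : ℕ → ℝ) (hx0 : x 0 = Int.fract α)
    (hx : ∀ n, x (n + 1) = Int.fract (1 / x n))
    (A : ℕ → ℝ) (hA0 : A 0 = α) (hA : ∀ n, A (n + 1) = 1 / x n)
    (γ : ℝ) (hγ : γ = (1 + Real.sqrt 5) / 2) :
    ∀ j n : ℕ, j ≤ n →
      (∑ m ∈ Finset.Icc j n, ∏ i ∈ Finset.range (m + 1), A i) ≤
        γ ^ 3 * ∏ i ∈ Finset.range (n + 1), A i := by
  intro j n _
  have hmem := gauss_orbit_mem_Ioo hirr hx0 hx
  have hApos : ∀ i, 0 < A i := by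
    rintro (_ | i)
    · rwa [hA0]
    · rw [hA]; exact one_div_pos.mpr (hmem i).1
  have hone : ∀ i, 1 ≤ A (i + 1) := fun i => by
    rw [hA]; exact (one_le_div (hmem i).1).mpr (hmem i).2.le
  have htwo : ∀ i, 2 ≤ A (i + 1) * A (i + 2) := fun i => by
    rw [hA, hA, hx]
    exact two_le_one_div_mul_one_div_fract (hmem i) (hx i ▸ (hmem (i + 1)).1)
  set T : ℕ → ℝ := fun m => ∏ i ∈ Finset.range (m + 1), A i
  have hTpos : ∀ m, 0 < T m := fun m => Finset.prod_pos fun i _ => hApos i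
  have hTsucc : ∀ m, T (m + 1) = T m * A (m + 1) := fun m => Finset.prod_range_succ _ _
  have hsum : ∑ m ∈ Finset.range (n + 1), T m ≤ 4 * T n := by
    refine sum_range_le_four_mul hTpos (fun m => ?_) (fun m => ?_) n
    · rw [hTsucc]
      exact le_mul_of_one_le_right (hTpos m).le (hone m)
    · rw [hTsucc, hTsucc, mul_assoc, mul_comm 2]
      exact mul_le_mul_of_nonneg_left (htwo m) (hTpos m).le
  have hγ3 : 4 ≤ γ ^ 3 := by
    have hsq : Real.sqrt 5 ^ 2 = 5 := Real.sq_sqrt (by norm_num)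
    have hle : 2 ≤ Real.sqrt 5 := Real.le_sqrt_of_sq_le (by norm_num)
    have hcube : γ ^ 3 = 2 + Real.sqrt 5 := by
      rw [hγ]
      linear_combination (3 / 8 + Real.sqrt 5 / 8) * hsq
    linarith
  calc ∑ m ∈ Finset.Icc j n, T m ≤ ∑ m ∈ Finset.range (n + 1), T m :=
        Finset.sum_le_sum_of_subset_of_nonneg
          (fun m hm => Finset.mem_range.mpr (Nat.lt_succ_of_le (Finset.mem_Icc.mp hm).2))
          (fun m _ _ => (hTpos m).le)
    _ ≤ 4 * T n := hsum
    _ ≤ γ ^ 3 * T n := mul_le_mul_of_nonneg_right hγ3 (hTpos n).le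
end

section
/- Let β ≥ 0 and let α_0 > 1 be an irrational diophantine number of order β, with complete quotients α_n, continued fraction coefficients a_n = ⌊α_n⌋, Ã_{-1} = 1 and Ã_n = ∏_{i=0}^n α_i; set ω_n = (1, α_n) and T_n = T_{a_n}, and let γ = (1+√5)/2. Suppose 0 < σ < (1/2)(1 + 4γ³)^{-1}. Then there is a constant C > 0, independent of j, n and k, such that: for all 0 ≤ j ≤ n and every nonzero k ∈ ℤ² satisfying |ω_{i+1} · (T_i T_{i-1} ⋯ T_j k)| ≤ σ · ‖T_i T_{i-1} ⋯ T_j k‖ for every i = j, …, n, one has ‖k‖^{2+β} ≥ C · (Ã_n Ã_{n+1}) / (σ · Ã_{j-1}^{2+β}). -/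
/-- A lower bound on the linear form `p + α q` for a diophantine number `α`. -/
theorem exists_le_abs_linearForm_mul_rpow {α β : ℝ} (hβ : 0 ≤ β)
    (hdio : ∃ C > (0 : ℝ), ∀ p : ℤ, ∀ q : ℕ, 0 < q →
      C / (q : ℝ) ^ ((2 : ℝ) + β) < |α - (p : ℝ) / (q : ℝ)|) :
    ∃ c > (0 : ℝ), ∀ k : ℤ × ℤ, k ≠ 0 → ∀ Y : ℝ, 1 ≤ Y → |(k.2 : ℝ)| ≤ 3 * Y →
      c ≤ |(k.1 : ℝ) + α * (k.2 : ℝ)| * Y ^ ((1 : ℝ) + β) := by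
  obtain ⟨C, hC, hdio⟩ := hdio
  have h3 : (0 : ℝ) < 3 ^ ((1 : ℝ) + β) := by positivity
  refine ⟨min (C / 3 ^ ((1 : ℝ) + β)) 1, lt_min (by positivity) one_pos, ?_⟩
  rintro ⟨p, q⟩ hk Y hY hq
  simp only at hq ⊢
  have hY0 : 0 < Y := by linarith
  by_cases hq0 : q = 0
  · subst hq0
    have hp : p ≠ 0 := fun h => hk (by simp [h])
    have hp1 : (1 : ℝ) ≤ |(p : ℝ)| := by exact_mod_cast Int.one_le_abs hp
    have hY1 : 1 ≤ Y ^ ((1 : ℝ) + β) := Real.one_le_rpow hY (by linarith)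
    refine (min_le_right _ _).trans ?_
    simpa using one_le_mul_of_one_le_of_one_le hp1 hY1
  · refine (min_le_left _ _).trans ?_
    rw [div_le_iff₀ h3, mul_assoc, ← Real.mul_rpow hY0.le (by norm_num), mul_comm Y]
    have hQ : 0 < |(q : ℝ)| := by positivity
    have hd := hdio (-(q.sign * p)) q.natAbs (Int.natAbs_pos.mpr hq0)
    have hform : |α - ((-(q.sign * p) : ℤ) : ℝ) / (q.natAbs : ℝ)| * |(q : ℝ)| =
        |(p : ℝ) + α * q| := by
      have hcast : ((q.natAbs : ℕ) : ℝ) = |(q : ℝ)| := by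
        rw [Nat.cast_natAbs, Int.cast_abs]
      have hmul : ∀ y : ℝ, |y| * |(q : ℝ)| = |y * abs (q : ℝ)| := fun y => by
        rw [abs_mul, abs_abs]
      rw [hcast, hmul, sub_mul, div_mul_cancel₀ _ hQ.ne']
      rcases lt_or_gt_of_ne hq0 with h | h
      · have hneg : |(q : ℝ)| = -q := abs_of_neg (by exact_mod_cast h)
        rw [Int.sign_eq_neg_one_of_neg h, hneg, ← abs_neg]
        congr 1
        push_cast
        ring
      · have hpos : |(q : ℝ)| = q := abs_of_pos (by exact_mod_cast h)
        rw [Int.sign_eq_one_of_pos h, hpos]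
        congr 1
        push_cast
        ring
    rw [Nat.cast_natAbs, Int.cast_abs, div_lt_iff₀ (by positivity)] at hd
    have hsplit : |(q : ℝ)| ^ ((2 : ℝ) + β) = |(q : ℝ)| * |(q : ℝ)| ^ ((1 : ℝ) + β) := by
      rw [← Real.rpow_one_add' hQ.le (by linarith)]
      congr 1
      ring
    rw [Nat.cast_natAbs, Int.cast_abs] at hform
    rw [hsplit, ← mul_assoc, hform] at hd
    refine hd.le.trans ?_
    gcongr

/-- The complete quotients of an irrational number exceed one, and satisfy
`α_n = ⌊α_n⌋ + 1 / α_{n+1}`. -/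
theorem completeQuotient_spec {α : ℝ} (hirr : Irrational α) (hgt1 : 1 < α)
    {x A : ℕ → ℝ} (hx0 : x 0 = Int.fract α) (hx : ∀ n, x (n + 1) = Int.fract (1 / x n))
    (hA0 : A 0 = α) (hA : ∀ n, A (n + 1) = 1 / x n) (n : ℕ) :
    1 < A n ∧ A n = ⌊A n⌋ + 1 / A (n + 1) := by
  have hfract : ∀ n, x n = Int.fract (A n) := by
    rintro (_ | n)
    · rw [hx0, hA0]
    · rw [hx, hA]
  have hfractIrr : ∀ y : ℝ, Irrational y → Irrational (Int.fract y) := fun y hy =>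
    Int.self_sub_floor y ▸ hy.sub_intCast ⌊y⌋
  have hirrA : ∀ n, Irrational (A n) := by
    intro n
    induction n with
    | zero => rwa [hA0]
    | succ n ih =>
      rw [hA, hfract, one_div]
      exact (hfractIrr _ ih).inv
  constructor
  · rcases n with _ | n
    · rwa [hA0]
    · have hne := (hfractIrr _ (hirrA n)).ne_zero
      rw [hA, hfract]
      exact one_lt_one_div ((Int.fract_nonneg _).lt_of_ne hne.symm) (Int.fract_lt_one _)
  · rw [hA, one_div_one_div, hfract, Int.floor_add_fract]

theorem two_le_completeQuotient_mul {A : ℕ → ℝ} (h1 : ∀ n, 1 < A n)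
    (hstep : ∀ n, A n = ⌊A n⌋ + 1 / A (n + 1)) (n : ℕ) : 2 ≤ A n * A (n + 1) := by
  have h0 : 0 < A (n + 1) := by linarith [h1 (n + 1)]
  have hfl : (1 : ℝ) ≤ ⌊A n⌋ := by exact_mod_cast Int.le_floor.mpr (by simpa using (h1 n).le)
  have h : A n * A (n + 1) = ⌊A n⌋ * A (n + 1) + 1 := by
    conv_lhs => rw [hstep n]
    field_simp
  nlinarith [h1 (n + 1)]

theorem one_le_completeQuotient_prod {A At : ℕ → ℝ} (h1 : ∀ n, 1 < A n)
    (hAt0 : At 0 = 1) (hAts : ∀ n, At (n + 1) = At n * A n) (n : ℕ) : 1 ≤ At n := by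
  induction n with
  | zero => rw [hAt0]
  | succ n ih => rw [hAts]; nlinarith [h1 n]

/-- The transfer matrix multiplies the linear form by the next complete quotient. -/
theorem linearForm_succ {A p q : ℕ → ℝ} (h1 : ∀ n, 1 < A n)
    (hstep : ∀ n, A n = ⌊A n⌋ + 1 / A (n + 1))
    (hp : ∀ n, p (n + 1) = q n) (hq : ∀ n, q (n + 1) = p n + ⌊A n⌋ * q n) (n : ℕ) :
    p (n + 1) + A (n + 1) * q (n + 1) = A (n + 1) * (p n + A n * q n) := by
  have h0 : A (n + 1) ≠ 0 := by linarith [h1 (n + 1)]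
  have hA : A (n + 1) * A n = A (n + 1) * ⌊A n⌋ + 1 := by
    conv_lhs => rw [hstep n]
    field_simp
  rw [hp, hq]
  linear_combination -(q n) * hA

theorem linearForm_eq_prod {A At p q : ℕ → ℝ} (h1 : ∀ n, 1 < A n)
    (hstep : ∀ n, A n = ⌊A n⌋ + 1 / A (n + 1))
    (hAt0 : At 0 = 1) (hAts : ∀ n, At (n + 1) = At n * A n)
    (hp : ∀ n, p (n + 1) = q n) (hq : ∀ n, q (n + 1) = p n + ⌊A n⌋ * q n) (n : ℕ) :
    A 0 * (p n + A n * q n) = At (n + 1) * (p 0 + A 0 * q 0) := by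
  induction n with
  | zero => rw [hAts, hAt0, one_mul]
  | succ n ih =>
    rw [linearForm_succ h1 hstep hp hq, hAts (n + 1), mul_left_comm, ih]
    ring

/-- One step of the recursion for the weighted second coordinate `Ã_n q_n`: it changes, up to
sign, by the weighted linear form, which itself at least doubles. -/
theorem weighted_step {A At p q : ℕ → ℝ} (h1 : ∀ n, 1 < A n)
    (hstep : ∀ n, A n = ⌊A n⌋ + 1 / A (n + 1))
    (hAt0 : At 0 = 1) (hAts : ∀ n, At (n + 1) = At n * A n)
    (hp : ∀ n, p (n + 1) = q n) (hq : ∀ n, q (n + 1) = p n + ⌊A n⌋ * q n) (n : ℕ) :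
    At (n + 2) * q (n + 1) =
        At (n + 1) * (p (n + 1) + A (n + 1) * q (n + 1)) - At (n + 1) * q n ∧
      2 * (At n * |p n + A n * q n|) ≤ At (n + 1) * |p (n + 1) + A (n + 1) * q (n + 1)| := by
  constructor
  · rw [hAts (n + 1), hp]
    ring
  · have hpos := one_le_completeQuotient_prod h1 hAt0 hAts n
    have h0 : 0 < A (n + 1) := by linarith [h1 (n + 1)]
    rw [linearForm_succ h1 hstep hp hq, abs_mul, abs_of_pos h0, hAts]
    have h := mul_le_mul_of_nonneg_right (two_le_completeQuotient_mul h1 hstep n)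
      (by positivity : 0 ≤ At n * |p n + A n * q n|)
    linarith

theorem weighted_forward_le {A At p q : ℕ → ℝ} (h1 : ∀ n, 1 < A n)
    (hstep : ∀ n, A n = ⌊A n⌋ + 1 / A (n + 1))
    (hAt0 : At 0 = 1) (hAts : ∀ n, At (n + 1) = At n * A n)
    (hp : ∀ n, p (n + 1) = q n) (hq : ∀ n, q (n + 1) = p n + ⌊A n⌋ * q n) {j m : ℕ}
    (hjm : j ≤ m) :
    At (m + 1) * |q m| ≤ At j * |p j| + 2 * (At m * |p m + A m * q m|) := by
  have hpos : ∀ n, 0 < At n := fun n =>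
    zero_lt_one.trans_le (one_le_completeQuotient_prod h1 hAt0 hAts n)
  induction m, hjm using Nat.le_induction with
  | base =>
    have h : |A j * q j| ≤ |p j + A j * q j| + |p j| := by
      simpa using abs_sub (p j + A j * q j) (p j)
    rw [abs_mul, abs_of_pos (zero_lt_one.trans (h1 j))] at h
    rw [hAts]
    nlinarith [hpos j, abs_nonneg (p j + A j * q j)]
  | succ m _ ih =>
    obtain ⟨he, hd⟩ := weighted_step h1 hstep hAt0 hAts hp hq m
    have h := abs_sub (At (m + 1) * (p (m + 1) + A (m + 1) * q (m + 1))) (At (m + 1) * q m)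
    rw [← he, abs_mul, abs_mul, abs_mul, abs_of_pos (hpos _), abs_of_pos (hpos _)] at h
    linarith

theorem weighted_backward_le {A At p q : ℕ → ℝ} (h1 : ∀ n, 1 < A n)
    (hstep : ∀ n, A n = ⌊A n⌋ + 1 / A (n + 1))
    (hAt0 : At 0 = 1) (hAts : ∀ n, At (n + 1) = At n * A n)
    (hp : ∀ n, p (n + 1) = q n) (hq : ∀ n, q (n + 1) = p n + ⌊A n⌋ * q n) (m : ℕ) :
    At 1 * |q 0| + At 0 * |p 0 + A 0 * q 0| ≤
      At (m + 1) * |q m| + 2 * (At m * |p m + A m * q m|) := by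
  have hpos : ∀ n, 0 < At n := fun n =>
    zero_lt_one.trans_le (one_le_completeQuotient_prod h1 hAt0 hAts n)
  induction m with
  | zero =>
    have := mul_nonneg (hpos 0).le (abs_nonneg (p 0 + A 0 * q 0))
    rw [zero_add]
    linarith
  | succ m ih =>
    obtain ⟨he, hd⟩ := weighted_step h1 hstep hAt0 hAts hp hq m
    have h := abs_sub (At (m + 1) * (p (m + 1) + A (m + 1) * q (m + 1))) (At (m + 2) * q (m + 1))
    rw [he, sub_sub_cancel, ← he, abs_mul, abs_mul, abs_mul, abs_of_pos (hpos _),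
      abs_of_pos (hpos _)] at h
    linarith

theorem abs_snd_zero_le {A At p q : ℕ → ℝ} (h1 : ∀ n, 1 < A n)
    (hstep : ∀ n, A n = ⌊A n⌋ + 1 / A (n + 1))
    (hAt0 : At 0 = 1) (hAts : ∀ n, At (n + 1) = At n * A n)
    (hp : ∀ n, p (n + 1) = q n) (hq : ∀ n, q (n + 1) = p n + ⌊A n⌋ * q n) (j : ℕ) :
    |q 0| ≤ 3 * (At j * (|p j| + |q j|)) := by
  rcases j with _ | m
  · rw [hAt0]
    linarith [abs_nonneg (p 0), abs_nonneg (q 0)]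
  · have hge := one_le_completeQuotient_prod h1 hAt0 hAts
    have hm : At m ≤ At (m + 1) := by
      rw [hAts]
      nlinarith [hge m, h1 m]
    have hb := weighted_backward_le h1 hstep hAt0 hAts hp hq m
    have h0 : 0 < A (m + 1) := by linarith [h1 (m + 1)]
    have hr : |p m + A m * q m| ≤ |p (m + 1)| + |q (m + 1)| := by
      have hs := linearForm_succ h1 hstep hp hq m
      have h := abs_add_le (p (m + 1)) (A (m + 1) * q (m + 1))
      rw [hs, abs_mul, abs_mul, abs_of_pos h0] at h
      nlinarith [h1 (m + 1), abs_nonneg (p (m + 1))]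
    have h2 : At m * |p m + A m * q m| ≤ At (m + 1) * (|p (m + 1)| + |q (m + 1)|) :=
      mul_le_mul hm hr (abs_nonneg _) (by linarith [hge (m + 1)])
    rw [← hp m] at hb h2
    rw [hAt0] at hb
    nlinarith [hge 1, hge (m + 1), abs_nonneg (q 0), abs_nonneg (q (m + 1)),
      abs_nonneg (p 0 + A 0 * q 0)]

/-- A vector that is resonant at time `m` has been contracted, up to a constant, by the product
of the complete quotients. -/
theorem weighted_norm_le_of_resonant {A At p q : ℕ → ℝ} (h1 : ∀ n, 1 < A n)
    (hstep : ∀ n, A n = ⌊A n⌋ + 1 / A (n + 1))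
    (hAt0 : At 0 = 1) (hAts : ∀ n, At (n + 1) = At n * A n)
    (hp : ∀ n, p (n + 1) = q n) (hq : ∀ n, q (n + 1) = p n + ⌊A n⌋ * q n) {j m : ℕ}
    (hjm : j ≤ m) {σ : ℝ} (hσ : σ ≤ 1 / 10)
    (hres : |p m + A m * q m| ≤ σ * (|p m| + |q m|)) :
    At m * (|p m| + |q m|) ≤ 4 * (At j * (|p j| + |q j|)) := by
  have hge := one_le_completeQuotient_prod h1 hAt0 hAts
  have hf := weighted_forward_le h1 hstep hAt0 hAts hp hq hjm
  have hr : |p m + A m * q m| ≤ 1 / 10 * (|p m| + |q m|) := hres.trans (by gcongr)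
  have h : |p m| ≤ |p m + A m * q m| + A m * |q m| := by
    have h := abs_sub (p m + A m * q m) (A m * q m)
    rwa [add_sub_cancel_right, abs_mul, abs_of_pos (zero_lt_one.trans (h1 m))] at h
  have hN : |p m| + |q m| ≤ 1 / 10 * (|p m| + |q m|) + 2 * (A m * |q m|) := by
    nlinarith [abs_nonneg (q m), h1 m]
  have hN' := mul_le_mul_of_nonneg_left hN (zero_le_one.trans (hge m))
  have hr' := mul_le_mul_of_nonneg_left hr (zero_le_one.trans (hge m))
  have hqj := mul_nonneg (zero_le_one.trans (hge j)) (abs_nonneg (q j))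
  rw [hAts] at hf
  linarith


/-- Key estimate of Proposition 7 (convergence on the stable manifold):
for `α₀ > 1` irrational and diophantine of order `β ≥ 0`, with complete
quotients `A n`, coefficients `a n = ⌊A n⌋`, shifted products
`At m = Ã_{m-1} = ∏_{i=0}^{m-1} α_i` (so `At 0 = Ã_{-1} = 1`), vectors
`ω_n = (1, α_n)` and transfer matrices `T_n = T_{a_n}` (rows `(0,1)`,
`(1,a_n)`), and `0 < σ < (1/2)(1+4γ³)⁻¹`: there is `C > 0` such that every
nonzero `k ∈ ℤ²` remaining `σ`-resonant under `T_j, …, T_n`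
(i.e. `|ω_{i+1}·(T_i⋯T_j k)| ≤ σ‖T_i⋯T_j k‖` for `i = j, …, n`, orbit encoded
by `u`) satisfies `‖k‖^{2+β} ≥ C Ã_n Ã_{n+1} / (σ Ã_{j-1}^{2+β})`, with the
`ℓ¹` norm on `ℤ²`. -/
theorem stmt_18 (β : ℝ) (hβ : 0 ≤ β)
    (α : ℝ) (hirr : Irrational α) (hgt1 : 1 < α)
    (hdio : ∃ C > (0 : ℝ), ∀ p : ℤ, ∀ q : ℕ, 0 < q →
        C / (q : ℝ) ^ ((2 : ℝ) + β) < |α - (p : ℝ) / (q : ℝ)|)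
    (x : ℕ → ℝ) (hx0 : x 0 = Int.fract α)
    (hx : ∀ n, x (n + 1) = Int.fract (1 / x n))
    (A : ℕ → ℝ) (hA0 : A 0 = α) (hA : ∀ n, A (n + 1) = 1 / x n)
    (At : ℕ → ℝ) (hAt : ∀ n, At n = ∏ i ∈ Finset.range n, A i)
    (T : ℤ → ℤ × ℤ → ℤ × ℤ) (hT : ∀ a k, T a k = (k.2, k.1 + a * k.2))
    (γ : ℝ) (hγ : γ = (1 + Real.sqrt 5) / 2)
    (σ : ℝ) (hσ0 : 0 < σ) (hσ : σ < (1 / 2) * (1 + 4 * γ ^ 3)⁻¹) :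
    ∃ C > (0 : ℝ), ∀ j n : ℕ, j ≤ n → ∀ k : ℤ × ℤ, k ≠ 0 →
      ∀ u : ℕ → ℤ × ℤ, u j = k →
      (∀ i, u (i + 1) = T ⌊A i⌋ (u i)) →
      (∀ i, j ≤ i → i ≤ n →
        |((u (i + 1)).1 : ℝ) + A (i + 1) * ((u (i + 1)).2 : ℝ)| ≤
          σ * (|((u (i + 1)).1 : ℝ)| + |((u (i + 1)).2 : ℝ)|)) →
      (|(k.1 : ℝ)| + |(k.2 : ℝ)|) ^ ((2 : ℝ) + β) ≥
        C * (At (n + 1) * At (n + 2)) / (σ * At j ^ ((2 : ℝ) + β)) := by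
  have hspec := completeQuotient_spec hirr hgt1 hx0 hx hA0 hA
  have h1 : ∀ n, 1 < A n := fun n => (hspec n).1
  have hstep : ∀ n, A n = ⌊A n⌋ + 1 / A (n + 1) := fun n => (hspec n).2
  have hAt0 : At 0 = 1 := by simp [hAt]
  have hAts : ∀ n, At (n + 1) = At n * A n := fun n => by
    rw [hAt, hAt, Finset.prod_range_succ]
  have hge := one_le_completeQuotient_prod h1 hAt0 hAts
  have hσ10 : σ ≤ 1 / 10 := by
    have hγ1 : 1 ≤ γ := by
      have : (1 : ℝ) ≤ Real.sqrt 5 := Real.one_le_sqrt.mpr (by norm_num)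
      rw [hγ]
      linarith
    have hγ3 : 1 ≤ γ ^ 3 := one_le_pow₀ hγ1
    have hinv : (1 + 4 * γ ^ 3)⁻¹ ≤ (5 : ℝ)⁻¹ := by
      gcongr
      linarith
    linarith
  obtain ⟨c, hc, hdio'⟩ := exists_le_abs_linearForm_mul_rpow hβ hdio
  refine ⟨c / (4 * α), by positivity, ?_⟩
  intro j n hjn k hk u huj hu hres
  set p : ℕ → ℝ := fun i => ((u i).1 : ℝ) with hpdef
  set q : ℕ → ℝ := fun i => ((u i).2 : ℝ) with hqdef
  have hp : ∀ i, p (i + 1) = q i := fun i => by simp [hpdef, hqdef, hu i, hT]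
  have hq : ∀ i, q (i + 1) = p i + ⌊A i⌋ * q i := fun i => by simp [hpdef, hqdef, hu i, hT]
  have hu0 : u 0 ≠ 0 := by
    intro h
    have hz : ∀ i, u i = 0 := fun i => by
      induction i with
      | zero => exact h
      | succ i ih => simp [hu i, hT, ih]
    exact hk (huj ▸ hz j)
  have hk1 : (1 : ℝ) ≤ |(k.1 : ℝ)| + |(k.2 : ℝ)| := by
    have hZ : 1 ≤ |k.1| + |k.2| := by
      by_contra! hlt
      exact hk (Prod.ext (abs_nonpos_iff.mp (by linarith [abs_nonneg k.2]))
        (abs_nonpos_iff.mp (by linarith [abs_nonneg k.1])))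
    exact_mod_cast hZ
  set Y : ℝ := At j * (|(k.1 : ℝ)| + |(k.2 : ℝ)|) with hY
  have hY1 : 1 ≤ Y := one_le_mul_of_one_le_of_one_le (hge j) hk1
  have hYeq : At j * (|p j| + |q j|) = Y := by simp only [hpdef, hqdef, huj, hY]
  have hq0 : |q 0| ≤ 3 * Y := hYeq ▸ abs_snd_zero_le h1 hstep hAt0 hAts hp hq j
  have hlow : c ≤ |p 0 + α * q 0| * Y ^ ((1 : ℝ) + β) := hdio' (u 0) hu0 Y hY1 hq0
  have hresn : |p (n + 1) + A (n + 1) * q (n + 1)| ≤ σ * (|p (n + 1)| + |q (n + 1)|) :=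
    hres n hjn le_rfl
  have hcontr : At (n + 1) * (|p (n + 1)| + |q (n + 1)|) ≤ 4 * Y :=
    hYeq ▸ weighted_norm_le_of_resonant h1 hstep hAt0 hAts hp hq (by omega) hσ10 hresn
  have hform : α * |p (n + 1) + A (n + 1) * q (n + 1)| = At (n + 2) * |p 0 + α * q 0| := by
    have h := congrArg abs (linearForm_eq_prod h1 hstep hAt0 hAts hp hq (n + 1))
    rwa [hA0, abs_mul, abs_mul, abs_of_pos (by linarith),
      abs_of_pos (zero_lt_one.trans_le (hge _))] at h
  have hAtj : 0 < At j := zero_lt_one.trans_le (hge j)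
  have hn1 : 0 < At (n + 1) := zero_lt_one.trans_le (hge _)
  have hn2 : 0 < At (n + 2) := zero_lt_one.trans_le (hge _)
  have hα : 0 < α := by linarith
  have hYpos : 0 < Y := by linarith
  have hmain : c * (At (n + 1) * At (n + 2)) ≤ 4 * α * σ * Y ^ ((2 : ℝ) + β) := by
    have hsplit : Y ^ ((2 : ℝ) + β) = Y * Y ^ ((1 : ℝ) + β) := by
      rw [← Real.rpow_one_add' hYpos.le (by linarith)]
      congr 1
      ring
    calc c * (At (n + 1) * At (n + 2))
        ≤ |p 0 + α * q 0| * Y ^ ((1 : ℝ) + β) * (At (n + 1) * At (n + 2)) := by gcongr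
      _ = At (n + 1) * (At (n + 2) * |p 0 + α * q 0|) * Y ^ ((1 : ℝ) + β) := by ring
      _ = At (n + 1) * (α * |p (n + 1) + A (n + 1) * q (n + 1)|) * Y ^ ((1 : ℝ) + β) := by
        rw [hform]
      _ ≤ At (n + 1) * (α * (σ * (|p (n + 1)| + |q (n + 1)|))) * Y ^ ((1 : ℝ) + β) := by
        gcongr
      _ = α * σ * (At (n + 1) * (|p (n + 1)| + |q (n + 1)|)) * Y ^ ((1 : ℝ) + β) := by ring
      _ ≤ α * σ * (4 * Y) * Y ^ ((1 : ℝ) + β) := by gcongr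
      _ = 4 * α * σ * Y ^ ((2 : ℝ) + β) := by rw [hsplit]; ring
  rw [hY, Real.mul_rpow hAtj.le (by linarith)] at hmain
  rw [ge_iff_le, div_le_iff₀ (by positivity), div_mul_eq_mul_div, div_le_iff₀ (by positivity)]
  linarith
end

section
/- Let α > 1 be irrational, let x = {α} be its fractional part, and let α' = 1/x. Define the 2×2 real matrix G = (α'/(1+x²)) · [[-α, 1], [xα, -x]]. Then: det G = 0; G maps the vector (1, α) to 0 (so 0 is an eigenvalue with eigenvector (1, α)); the vector (1, -1/α') = (1, -x) is an eigenvector of G with eigenvalue ν = tr G = -α'(α + x)/(1 + x²); and |ν| > 1. -/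
/-- Spectral description of the derivative of the renormalisation on the
constant modes: for `α > 1` irrational, `x = {α}`, `α' = 1/x` and
`G = (α'/(1+x²)) • [[-α, 1], [xα, -x]]`, one has `det G = 0`, `G (1,α) = 0`,
`(1, -1/α') = (1, -x)` is an eigenvector of `G` with eigenvalue
`ν = tr G = -α'(α+x)/(1+x²)`, and `|ν| > 1`. -/
theorem stmt_19 (α : ℝ) (hirr : Irrational α) (hgt1 : 1 < α)
    (x : ℝ) (hxdef : x = Int.fract α)
    (α' : ℝ) (hα' : α' = 1 / x)
    (G : Matrix (Fin 2) (Fin 2) ℝ)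
    (hG : G = (α' / (1 + x ^ 2)) • !![-α, 1; x * α, -x])
    (ν : ℝ) (hν : ν = Matrix.trace G) :
    G.det = 0 ∧
    G.mulVec ![1, α] = 0 ∧
    G.mulVec ![1, -(1 / α')] = ν • ![1, -(1 / α')] ∧
    ν = -(α' * (α + x)) / (1 + x ^ 2) ∧
    1 < |ν| := by
  have hx0 : 0 < x := by
    rw [hxdef, Int.fract_pos]
    exact hirr.ne_int _
  have hx1 : x < 1 := hxdef ▸ Int.fract_lt_one α
  have hν' : ν = -(α' * (α + x)) / (1 + x ^ 2) := by
    rw [hν, hG]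
    simp [Matrix.trace_fin_two]
    ring
  have hinv : 1 / α' = x := by rw [hα', one_div_one_div]
  refine ⟨?_, ?_, ?_, hν', ?_⟩
  · rw [hG, Matrix.det_smul, Matrix.det_fin_two_of]
    ring
  · rw [hG]
    ext i
    fin_cases i <;> simp [Matrix.mulVec, dotProduct, Fin.sum_univ_two]
    ring
  · rw [hinv, hν', hG]
    ext i
    fin_cases i <;> simp [Matrix.mulVec, dotProduct, Fin.sum_univ_two] <;> ring
  · have hx3 : x ^ 3 < 1 := pow_lt_one₀ hx0.le hx1 three_ne_zero
    have hνx : -ν = (α + x) / (x * (1 + x ^ 2)) := by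
      rw [hν', hα']
      field_simp
    refine lt_of_lt_of_le ?_ (neg_le_abs ν)
    rw [hνx, one_lt_div (by positivity)]
    linarith
end
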